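/- Pipage approximation guarantee: suppose each delivery station j ∈ J is connected to I_j ⊆ I with |I_j| ≤ m (m ≥ 1) and all schedule matrices considered satisfy x_{ijτ} = 0 for i ∉ I_j. Let opt denote the maximum of g over feasible binary schedule matrices, let X⁽⁰⁾ be a fractional schedule matrix with entries in [0,1] satisfying f(X⁽⁰⁾) ≥ opt, and let X⁽ᴸ⁾ be a binary schedule matrix with g(X⁽ᴸ⁾) ≥ g(X⁽⁰⁾) (as guaranteed along pipage steps). Then g(X⁽ᴸ⁾) ≥ ρ(mT) · opt, where T is the number of timeslots. -/

import Mathlib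

open Finset

theorem Finset.prod_one_sub_le_pow {ι : Type*} (s : Finset ι) (y : ι → ℝ)
    (hy : ∀ e ∈ s, y e ≤ 1) {n : ℕ} (hn : n ≠ 0) (hs : s.card ≤ n) :
    ∏ e ∈ s, (1 - y e) ≤ (1 - (∑ e ∈ s, y e) / n) ^ n := by
  have hn' : (n : ℝ) ≠ 0 := Nat.cast_ne_zero.mpr hn
  have hcard : (s.card : ℝ) ≤ n := Nat.cast_le.mpr hs
  have hz : ∀ e ∈ s, 0 ≤ 1 - y e := fun e he => sub_nonneg.mpr (hy e he)
  have key := Real.geom_mean_le_arith_mean_weighted (Finset.insertNone s)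
    (fun o => o.elim (((n : ℝ) - s.card) / n) (fun _ => (n : ℝ)⁻¹))
    (fun o => o.elim 1 (fun e => 1 - y e))
    (by
      rintro (_ | e) _
      · exact div_nonneg (sub_nonneg.mpr hcard) n.cast_nonneg
      · exact inv_nonneg.mpr n.cast_nonneg)
    (by
      rw [Finset.sum_insertNone]
      simp only [Option.elim, Finset.sum_const, nsmul_eq_mul]
      field_simp
      ring)
    (by
      rintro (_ | e) he
      · exact zero_le_one
      · exact hz e (by simpa using he))
  rw [Finset.sum_insertNone, Finset.prod_insertNone] at key
  simp only [Option.elim, Real.one_rpow, one_mul, mul_one] at key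
  rw [Real.finsetProd_rpow s _ hz, ← Finset.mul_sum, Finset.sum_sub_distrib, Finset.sum_const,
    nsmul_eq_mul, mul_one] at key
  have hmean : ((n : ℝ) - s.card) / n + (n : ℝ)⁻¹ * (s.card - ∑ e ∈ s, y e)
      = 1 - (∑ e ∈ s, y e) / n := by
    field_simp
    ring
  rw [hmean] at key
  have hprod := Finset.prod_nonneg hz
  calc ∏ e ∈ s, (1 - y e) = ((∏ e ∈ s, (1 - y e)) ^ (n : ℝ)⁻¹) ^ n :=
        (Real.rpow_inv_natCast_pow hprod hn).symm
    _ ≤ _ := pow_le_pow_left₀ (Real.rpow_nonneg hprod _) key n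

theorem one_sub_div_pow_le {n : ℕ} (hn : n ≠ 0) {u : ℝ} (hu0 : 0 ≤ u) (hu1 : u ≤ 1) :
    (1 - u / n) ^ n ≤ 1 - (1 - (1 - 1 / (n : ℝ)) ^ n) * u := by
  have hn1 : (1 : ℝ) ≤ n := Nat.one_le_cast.mpr (Nat.one_le_iff_ne_zero.mpr hn)
  have hmem : 0 ≤ 1 - 1 / (n : ℝ) :=
    sub_nonneg.mpr ((div_le_one (zero_lt_one.trans_le hn1)).mpr hn1)
  have h := (convexOn_pow n).2 (Set.mem_Ici.mpr zero_le_one) (Set.mem_Ici.mpr hmem)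
    (sub_nonneg.mpr hu1) hu0 (sub_add_cancel 1 u)
  simp only [smul_eq_mul, one_pow] at h
  calc (1 - u / n) ^ n = ((1 - u) * 1 + u * (1 - 1 / (n : ℝ))) ^ n := by ring
    _ ≤ _ := h
    _ = _ := by ring

theorem Finset.mul_min_one_sum_le_one_sub_prod {ι : Type*} (s : Finset ι) (y : ι → ℝ)
    (hy : ∀ e ∈ s, y e ∈ Set.Icc (0 : ℝ) 1) {n : ℕ} (hs : s.card ≤ n) :
    (1 - (1 - 1 / (n : ℝ)) ^ n) * min 1 (∑ e ∈ s, y e) ≤ 1 - ∏ e ∈ s, (1 - y e) := by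
  rcases eq_or_ne n 0 with rfl | hn
  · obtain rfl : s = ∅ := Finset.card_eq_zero.mp (Nat.le_zero.mp hs)
    simp
  have hnpos : (0 : ℝ) < n := Nat.cast_pos.mpr (Nat.pos_of_ne_zero hn)
  have hsum0 : 0 ≤ ∑ e ∈ s, y e := Finset.sum_nonneg fun e he => (hy e he).1
  have hsumn : ∑ e ∈ s, y e ≤ n :=
    calc ∑ e ∈ s, y e ≤ s.card • (1 : ℝ) := Finset.sum_le_card_nsmul _ _ _ fun e he => (hy e he).2
      _ ≤ n := by simpa using hs
  have hbase : 0 ≤ 1 - (∑ e ∈ s, y e) / n := sub_nonneg.mpr ((div_le_one hnpos).mpr hsumn)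
  have hamgm := s.prod_one_sub_le_pow y (fun e he => (hy e he).2) hn hs
  have hmono : (1 - (∑ e ∈ s, y e) / n) ^ n ≤ (1 - min 1 (∑ e ∈ s, y e) / n) ^ n := by
    apply pow_le_pow_left₀ hbase
    gcongr
    exact min_le_right _ _
  have hconv := one_sub_div_pow_le hn (le_min zero_le_one hsum0) (min_le_left 1 (∑ e ∈ s, y e))
  linarith

theorem one_sub_one_sub_inv_pow_nonneg (n : ℕ) : 0 ≤ 1 - (1 - 1 / (n : ℝ)) ^ n := by
  rcases eq_or_ne n 0 with rfl | hn
  · simp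
  · have hn1 : (1 : ℝ) ≤ n := Nat.one_le_cast.mpr (Nat.one_le_iff_ne_zero.mpr hn)
    have hle : 1 / (n : ℝ) ≤ 1 := (div_le_one (zero_lt_one.trans_le hn1)).mpr hn1
    exact sub_nonneg.mpr (pow_le_one₀ (sub_nonneg.mpr hle) (sub_le_self _ (by positivity)))

/-- **Pipage approximation guarantee.**
Suppose each delivery station `j` is connected to `Ij j ⊆ I` with `|Ij j| ≤ m` (`m ≥ 1`)
and all schedule matrices considered vanish outside the connections.  Let `opt` be the
maximum of the covered demand `g` over feasible binary schedule matrices, let `X0` be a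
fractional schedule matrix with entries in `[0,1]` with `f(X0) ≥ opt`, and let `XL` be a
binary schedule matrix with `g(XL) ≥ g(X0)` (as guaranteed along pipage steps).  Then
`g(XL) ≥ ρ(mT) · opt` where `ρ(x) = 1 - (1 - 1/x)^x` and `T` is the number of
timeslots. -/
theorem pipage_guarantee
    {I J K T : Type*} [Fintype I] [Fintype J] [Fintype K] [Fintype T] [LinearOrder T]
    (a : I → K → ℝ) (d : J → K → T → ℝ)
    (ha : ∀ i k, a i k = 0 ∨ a i k = 1)
    (hd : ∀ j k t, 0 ≤ d j k t)
    (m : ℕ) (hm : 1 ≤ m) (Ij : J → Finset I) (hcard : ∀ j, (Ij j).card ≤ m)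
    (Feas : (I → J → T → ℝ) → Prop) (opt : ℝ)
    (hopt : IsGreatest {v : ℝ | ∃ X : I → J → T → ℝ, Feas X ∧
        (∀ i j τ, X i j τ = 0 ∨ X i j τ = 1) ∧
        (∀ i j τ, i ∉ Ij j → X i j τ = 0) ∧
        v = ∑ j, ∑ k, ∑ t, d j k t *
          (1 - ∏ i, ∏ τ ∈ Finset.univ.filter (fun τ => t ≤ τ), (1 - a i k * X i j τ))}
      opt)
    (X0 XL : I → J → T → ℝ)
    (hX0 : ∀ i j τ, X0 i j τ ∈ Set.Icc (0 : ℝ) 1)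
    (hX0z : ∀ i j τ, i ∉ Ij j → X0 i j τ = 0)
    (hf : opt ≤ ∑ j, ∑ k, ∑ t, d j k t *
        min 1 (∑ i, ∑ τ ∈ Finset.univ.filter (fun τ => t ≤ τ), a i k * X0 i j τ))
    (hXL : ∀ i j τ, XL i j τ = 0 ∨ XL i j τ = 1)
    (hXLz : ∀ i j τ, i ∉ Ij j → XL i j τ = 0)
    (hpipage : (∑ j, ∑ k, ∑ t, d j k t *
          (1 - ∏ i, ∏ τ ∈ Finset.univ.filter (fun τ => t ≤ τ), (1 - a i k * X0 i j τ)))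
        ≤ ∑ j, ∑ k, ∑ t, d j k t *
          (1 - ∏ i, ∏ τ ∈ Finset.univ.filter (fun τ => t ≤ τ), (1 - a i k * XL i j τ))) :
    (1 - (1 - 1 / ((m * Fintype.card T : ℕ) : ℝ)) ^ (m * Fintype.card T)) * opt
      ≤ ∑ j, ∑ k, ∑ t, d j k t *
          (1 - ∏ i, ∏ τ ∈ Finset.univ.filter (fun τ => t ≤ τ), (1 - a i k * XL i j τ)) := by
  refine le_trans ?_ hpipage
  refine (mul_le_mul_of_nonneg_left hf (one_sub_one_sub_inv_pow_nonneg _)).trans ?_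
  simp only [Finset.mul_sum]
  refine Finset.sum_le_sum fun j _ => Finset.sum_le_sum fun k _ => Finset.sum_le_sum fun t _ => ?_
  rw [mul_left_comm]
  refine mul_le_mul_of_nonneg_left ?_ (hd j k t)
  have hsum : ∑ i, ∑ τ ∈ Finset.univ.filter (fun τ => t ≤ τ), a i k * X0 i j τ
      = ∑ e ∈ Ij j ×ˢ Finset.univ.filter (fun τ => t ≤ τ), a e.1 k * X0 e.1 j e.2 := by
    rw [Finset.sum_product]
    refine (Finset.sum_subset (Finset.subset_univ _) fun i _ hi => ?_).symm
    exact Finset.sum_eq_zero fun τ _ => by rw [hX0z i j τ hi, mul_zero]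
  have hprod : ∏ i, ∏ τ ∈ Finset.univ.filter (fun τ => t ≤ τ), (1 - a i k * X0 i j τ)
      = ∏ e ∈ Ij j ×ˢ Finset.univ.filter (fun τ => t ≤ τ), (1 - a e.1 k * X0 e.1 j e.2) := by
    rw [Finset.prod_product]
    refine (Finset.prod_subset (Finset.subset_univ _) fun i _ hi => ?_).symm
    exact Finset.prod_eq_one fun τ _ => by rw [hX0z i j τ hi, mul_zero, sub_zero]
  rw [hsum, hprod]
  refine Finset.mul_min_one_sum_le_one_sub_prod _ (fun e : I × T => a e.1 k * X0 e.1 j e.2) ?_ ?_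
  · rintro ⟨i, τ⟩ -
    rcases ha i k with h | h
    · simp [h]
    · simpa [h] using hX0 i j τ
  · rw [Finset.card_product]
    exact Nat.mul_le_mul (hcard j) (Finset.card_le_univ _)
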